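/- Let G be a finite simple graph with vertex set V of size n ≥ 4 and minimum degree at least 1, let λ ≥ 1 be a real number such that every nonempty proper subset S' of V satisfies |C(S')| ≥ λ, and let ε ∈ (0,1] be a real number. Let S ⊆ V with 2 ≤ |S| ≤ n - 2 and |C(S)| ≤ (2-ε)·λ. Consider a random 1-out sample of G: independently for each vertex v, choose a uniformly random edge incident to v. Then the probability that no chosen edge belongs to C(S) equals ∏_{v ∈ V} (1 - c_S(v)/d(v)), and this probability is at least exp(-4(2-ε)/ε). -/

import Mathlib

/-- The cut `C(S)`: the set of edges of `G` with exactly one endpoint in `S`. -/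
def SimpleGraph.cutEdges {V : Type*} [Fintype V] [DecidableEq V] (G : SimpleGraph V)
    [DecidableRel G.Adj] (S : Finset V) : Finset (Sym2 V) :=
  G.edgeFinset.filter (fun e => ∃ a b, e = s(a, b) ∧ a ∈ S ∧ b ∉ S)

/-- `c_S(v)`: the number of edges of the cut `C(S)` incident to the vertex `v`. -/
def SimpleGraph.cutInc {V : Type*} [Fintype V] [DecidableEq V] (G : SimpleGraph V)
    [DecidableRel G.Adj] (S : Finset V) (v : V) : ℕ :=
  ((G.cutEdges S).filter (fun e => v ∈ e)).card

namespace SimpleGraph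

variable {V : Type*} [Fintype V] [DecidableEq V] (G : SimpleGraph V) [DecidableRel G.Adj]

theorem mk_mem_cutEdges (S : Finset V) (a b : V) :
    s(a, b) ∈ G.cutEdges S ↔ G.Adj a b ∧ ¬(a ∈ S ↔ b ∈ S) := by
  simp only [cutEdges, Finset.mem_filter, mem_edgeFinset, mem_edgeSet, Sym2.eq_iff]
  refine and_congr_right fun _ => ⟨?_, fun h => ?_⟩
  · rintro ⟨x, y, ⟨rfl, rfl⟩ | ⟨rfl, rfl⟩, hx, hy⟩ <;> tauto
  · by_cases ha : a ∈ S
    · exact ⟨a, b, Or.inl ⟨rfl, rfl⟩, ha, by tauto⟩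
    · exact ⟨b, a, Or.inr ⟨rfl, rfl⟩, by tauto, ha⟩

theorem cutEdges_symmDiff_singleton (S : Finset V) (v : V) :
    G.cutEdges (symmDiff S {v}) = symmDiff (G.cutEdges S) (G.incidenceFinset v) := by
  ext e
  induction e with
  | _ a b =>
    have hne : G.Adj a b → a ≠ b := fun h => h.ne
    simp only [mk_mem_cutEdges, Finset.mem_symmDiff, Finset.mem_singleton,
      mem_incidenceFinset, mk'_mem_incidenceSet_iff]
    by_cases ha : a = v <;> by_cases hb : b = v <;> grind

theorem cutEdges_singleton (v : V) : G.cutEdges {v} = G.incidenceFinset v := by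
  have h := G.cutEdges_symmDiff_singleton ∅ v
  have h0 : G.cutEdges ∅ = ∅ := by simp [cutEdges]
  rw [h0] at h
  simpa [symmDiff_def] using h

theorem cutInc_eq_card_inter (S : Finset V) (v : V) :
    G.cutInc S v = (G.cutEdges S ∩ G.incidenceFinset v).card := by
  unfold cutInc
  congr 1
  ext e
  simp only [Finset.mem_filter, Finset.mem_inter, mem_incidenceFinset, incidenceSet,
    Set.mem_sep_iff]
  refine and_congr_right fun he => ?_
  have : e ∈ G.edgeSet := mem_edgeFinset.1 (Finset.mem_filter.1 he).1
  tauto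

theorem card_cutEdges_symmDiff_singleton (S : Finset V) (v : V) :
    (G.cutEdges (symmDiff S {v})).card + 2 * G.cutInc S v =
      (G.cutEdges S).card + G.degree v := by
  rw [cutEdges_symmDiff_singleton, cutInc_eq_card_inter, ← card_incidenceFinset_eq_degree]
  have h1 := Finset.card_sdiff_add_card_inter (G.cutEdges S) (G.incidenceFinset v)
  have h2 := Finset.card_sdiff_add_card_inter (G.incidenceFinset v) (G.cutEdges S)
  rw [Finset.inter_comm] at h2
  have h3 : (symmDiff (G.cutEdges S) (G.incidenceFinset v)).card =
      (G.cutEdges S \ G.incidenceFinset v).card + (G.incidenceFinset v \ G.cutEdges S).card := by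
    rw [← Finset.card_union_of_disjoint disjoint_sdiff_sdiff]
    rfl
  omega

theorem sum_cutInc (S : Finset V) : ∑ v, G.cutInc S v = 2 * (G.cutEdges S).card := by
  have h (e : Sym2 V) (he : e ∈ G.cutEdges S) :
      (Finset.univ.filter fun v => v ∈ e).card = 2 := by
    have hd : ¬ e.IsDiag :=
      G.not_isDiag_of_mem_edgeSet (mem_edgeFinset.1 (Finset.mem_filter.1 he).1)
    rw [← Sym2.card_toFinset_of_not_isDiag e hd]
    congr 1
    ext v
    simp
  calc ∑ v, G.cutInc S v = ∑ e ∈ G.cutEdges S, (Finset.univ.filter fun v => v ∈ e).card :=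
        Finset.sum_card_bipartiteAbove_eq_sum_card_bipartiteBelow fun v e => v ∈ e
    _ = 2 * (G.cutEdges S).card := by
        rw [Finset.sum_congr rfl h, Finset.sum_const, smul_eq_mul, mul_comm]

theorem cutInc_eq_card_filter_neighborFinset (S : Finset V) (v : V) :
    G.cutInc S v = ((G.neighborFinset v).filter fun w => s(v, w) ∈ G.cutEdges S).card := by
  have hinj : Function.Injective fun w => s(v, w) := fun _ _ => Sym2.congr_right.1
  rw [cutInc, ← Finset.card_image_of_injective _ hinj]
  congr 1
  ext e
  simp only [Finset.mem_filter, Finset.mem_image, mem_neighborFinset]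
  constructor
  · rintro ⟨he, w, rfl⟩
    exact ⟨w, ⟨((G.mk_mem_cutEdges S v w).1 he).1, he⟩, rfl⟩
  · rintro ⟨w, ⟨-, he⟩, rfl⟩
    exact ⟨he, Sym2.mem_mk_left v w⟩

theorem card_filter_notMem_cutEdges_add_cutInc (S : Finset V) (v : V) :
    ((G.neighborFinset v).filter fun w => s(v, w) ∉ G.cutEdges S).card + G.cutInc S v =
      G.degree v := by
  rw [cutInc_eq_card_filter_neighborFinset, add_comm, Finset.card_filter_add_card_filter_not,
    card_neighborFinset_eq_degree]

theorem card_oneOut :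
    (Finset.univ.filter fun f : V → V => ∀ v, G.Adj v (f v)).card = ∏ v, G.degree v := by
  simp only [← card_neighborFinset_eq_degree]
  rw [← Fintype.card_piFinset]
  congr 1
  ext f
  simp [Fintype.mem_piFinset]

theorem card_oneOut_avoiding_cutEdges (S : Finset V) :
    (Finset.univ.filter fun f : V → V =>
      (∀ v, G.Adj v (f v)) ∧ ∀ v, s(v, f v) ∉ G.cutEdges S).card =
      ∏ v, ((G.neighborFinset v).filter fun w => s(v, w) ∉ G.cutEdges S).card := by
  rw [← Fintype.card_piFinset]
  congr 1
  ext f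
  simp [Fintype.mem_piFinset, forall_and]

end SimpleGraph

/-- A multiplicative form of `-x / (1 - x) ≤ log (1 - x)` for `x ≤ 1 - δ`. -/
theorem Real.exp_neg_div_le_one_sub {x δ : ℝ} (hx : 0 ≤ x) (hδ : 0 < δ) (h : x ≤ 1 - δ) :
    Real.exp (-(x / δ)) ≤ 1 - x := by
  have hpos : 0 < 1 - x := by linarith
  have h1 : (1 - x)⁻¹ ≤ x / δ + 1 := by
    have h2 : x / (1 - x) ≤ x / δ := div_le_div_of_nonneg_left hx hδ (by linarith)
    have h3 : (1 - x)⁻¹ = x / (1 - x) + 1 := by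
      field_simp
      ring
    linarith
  rw [Real.exp_neg]
  exact inv_le_of_inv_le₀ hpos (h1.trans (Real.add_one_le_exp _))

/-- Lemma 2.9.  A random 1-out sample is modelled by a uniformly random function
`f : V → V` with `f v` adjacent to `v` for every `v` (`f v` being the other endpoint of the
random edge chosen at `v`).  The probability that no chosen edge `s(v, f v)` lies in the
fixed non-singleton `(2-ε)`-minimum cut `C(S)` equals `∏_{v} (1 - c_S(v)/d(v))`, and is at
least `exp (-4(2-ε)/ε)`. -/
theorem oneOut_preserves_cut {V : Type*} [Fintype V] [DecidableEq V]
    (G : SimpleGraph V) [DecidableRel G.Adj]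
    (hn : 4 ≤ Fintype.card V) (hdeg : ∀ v, 1 ≤ G.degree v)
    (lam : ℝ) (hlam : 1 ≤ lam)
    (hmin : ∀ S' : Finset V, S'.Nonempty → S' ≠ Finset.univ →
      lam ≤ ((G.cutEdges S').card : ℝ))
    (ε : ℝ) (hε0 : 0 < ε) (hε1 : ε ≤ 1)
    (S : Finset V) (hS2 : 2 ≤ S.card) (hS2' : S.card ≤ Fintype.card V - 2)
    (hcut : ((G.cutEdges S).card : ℝ) ≤ (2 - ε) * lam) :
    (((Finset.univ.filter (fun f : V → V =>
          (∀ v, G.Adj v (f v)) ∧ ∀ v, s(v, f v) ∉ G.cutEdges S)).card : ℝ) /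
        ((Finset.univ.filter (fun f : V → V => ∀ v, G.Adj v (f v))).card : ℝ)) =
      ∏ v : V, (1 - (G.cutInc S v : ℝ) / (G.degree v : ℝ)) ∧
    Real.exp (-4 * (2 - ε) / ε) ≤
      ∏ v : V, (1 - (G.cutInc S v : ℝ) / (G.degree v : ℝ)) := by
  have hd (v : V) : (0 : ℝ) < G.degree v := by exact_mod_cast hdeg v
  refine ⟨?_, ?_⟩
  · rw [G.card_oneOut, G.card_oneOut_avoiding_cutEdges]
    push_cast
    rw [← Finset.prod_div_distrib]
    refine Finset.prod_congr rfl fun v _ => ?_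
    have h : ((((G.neighborFinset v).filter fun w => s(v, w) ∉ G.cutEdges S).card : ℕ) : ℝ) +
        G.cutInc S v = G.degree v := by
      exact_mod_cast G.card_filter_notMem_cutEdges_add_cutInc S v
    rw [one_sub_div (hd v).ne', ← h, add_sub_cancel_right]
  have hlamd (v : V) : lam ≤ G.degree v := by
    have h := hmin {v} (Finset.singleton_nonempty v) fun h => by
      have := congrArg Finset.card h
      rw [Finset.card_singleton, Finset.card_univ] at this
      omega
    rwa [G.cutEdges_singleton, G.card_incidenceFinset_eq_degree] at h
  have hratio (v : V) : (G.cutInc S v : ℝ) / G.degree v ≤ 1 - ε / 2 := by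
    have hne : (symmDiff S {v}).Nonempty := by
      obtain ⟨w, hw, hwv⟩ := Finset.exists_mem_ne (by omega : 1 < S.card) v
      exact ⟨w, by simp [Finset.mem_symmDiff, hw, hwv]⟩
    have hun : symmDiff S {v} ≠ Finset.univ := by
      have hc : 1 < Sᶜ.card := by
        rw [Finset.card_compl]
        omega
      obtain ⟨w, hw, hwv⟩ := Finset.exists_mem_ne hc v
      have hw' : w ∉ symmDiff S {v} := by
        simp [Finset.mem_symmDiff, Finset.mem_compl.1 hw, hwv]
      exact fun h => hw' (h ▸ Finset.mem_univ w)
    have h1 := hmin _ hne hun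
    have h2 : ((G.cutEdges (symmDiff S {v})).card : ℝ) + 2 * G.cutInc S v =
        (G.cutEdges S).card + G.degree v := by
      exact_mod_cast G.card_cutEdges_symmDiff_singleton S v
    rw [div_le_iff₀ (hd v)]
    nlinarith [mul_le_mul_of_nonneg_left (hlamd v) (sub_nonneg.2 hε1)]
  have hsum : ∑ v, (G.cutInc S v : ℝ) / G.degree v ≤ 2 * (2 - ε) := by
    have hpos : 0 < lam := by linarith
    calc ∑ v, (G.cutInc S v : ℝ) / G.degree v ≤ ∑ v, (G.cutInc S v : ℝ) / lam :=
          Finset.sum_le_sum fun v _ =>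
            div_le_div_of_nonneg_left (Nat.cast_nonneg _) hpos (hlamd v)
      _ = 2 * (G.cutEdges S).card / lam := by
          rw [← Finset.sum_div]
          congr 1
          exact_mod_cast G.sum_cutInc S
      _ ≤ 2 * (2 - ε) := by
          rw [div_le_iff₀ hpos]
          linarith
  calc Real.exp (-4 * (2 - ε) / ε)
      ≤ Real.exp (∑ v, -((G.cutInc S v : ℝ) / G.degree v / (ε / 2))) := by
        rw [Real.exp_le_exp, Finset.sum_neg_distrib, ← Finset.sum_div]
        have h := div_le_div_of_nonneg_right hsum (half_pos hε0).le
        have h' : -4 * (2 - ε) / ε = -(2 * (2 - ε) / (ε / 2)) := by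
          field_simp
          ring
        linarith
    _ = ∏ v, Real.exp (-((G.cutInc S v : ℝ) / G.degree v / (ε / 2))) := Real.exp_sum _ _
    _ ≤ _ := Finset.prod_le_prod (fun _ _ => (Real.exp_pos _).le) fun v _ =>
        Real.exp_neg_div_le_one_sub (by positivity) (half_pos hε0) (hratio v)
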